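/- Let D be an integral domain with quotient field K, let X be a family of indeterminates over K, and let R be a D-algebra with D ⊆ R ⊆ K[X]. If R ∩ K is pseudo-polynomial over D, then R is pseudo-polynomial over D. In particular, if R ∩ K = D (for example R = D[X] in one variable, or R = Int(D) = {f ∈ K[X] : f(D) ⊆ D}), then R is pseudo-polynomial over D. -/

import Mathlib

/-- The quotient field of a subring `D` of a field `F`, realized as the subfield of `F`
generated by `D` (its elements are exactly the fractions `a/b` with `a, b ∈ D`, `b ≠ 0`). -/
def quotField {F : Type*} [Field F] (D : Subring F) : Subfield F :=
  Subfield.closure (D : Set F)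

/-- An integral ideal `I` of `R` is *unitary* with respect to `D` if `I ∩ K ≠ (0)`,
where `K` is the quotient field of `D`. -/
def IsUnitaryIdeal {F : Type*} [Field F] (D R : Subring F) (I : Ideal R) : Prop :=
  ∃ x : R, x ∈ I ∧ x ≠ 0 ∧ (x : F) ∈ quotField D

/-- `R` is *pseudo-polynomial* over `D` if every principal integral ideal of `R` that is
unitary with respect to `D` is generated by an element of `D`. -/
def IsPseudoPoly {F : Type*} [Field F] (D R : Subring F) : Prop :=
  ∀ r : R, IsUnitaryIdeal D R (Ideal.span {r}) →
    ∃ d : R, (d : F) ∈ D ∧ Ideal.span {r} = Ideal.span {d}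

/-- `R` (a subring of the polynomial ring `K[X]` in a family `σ` of indeterminates,
where `K` is the quotient field of `D`) is *pseudo-polynomial over* `D`: every
principal integral ideal of `R` that is unitary with respect to `D` (i.e. contains a
nonzero element of `K = Frac(D)`, necessarily a constant polynomial) is generated by an
element of `D` (a constant polynomial with coefficient in `D`). -/
def IsPseudoPolyPolyRing {K : Type*} [Field K] (σ : Type*) (D : Subring K)
    (R : Subring (MvPolynomial σ K)) : Prop :=
  ∀ r : R,
    (∃ a : R, a ∈ Ideal.span {r} ∧ a ≠ 0 ∧
      ∃ c : K, c ∈ Subfield.closure (D : Set K) ∧ (a : MvPolynomial σ K) = MvPolynomial.C c) →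
    ∃ d : R, (∃ cd : K, cd ∈ D ∧ (d : MvPolynomial σ K) = MvPolynomial.C cd) ∧
      Ideal.span {r} = Ideal.span {d}

/-- Every subring of a field is pseudo-polynomial over itself. -/
theorem isPseudoPoly_self {F : Type*} [Field F] (D : Subring F) : IsPseudoPoly D D :=
  fun r _ => ⟨r, r.2, rfl⟩

/-- A polynomial over a field dividing a nonzero constant is a nonzero constant. -/
theorem MvPolynomial.exists_eq_C_of_mul_eq_C {K σ : Type*} [Field K] {p q : MvPolynomial σ K}
    {c : K} (hc : c ≠ 0) (h : p * q = MvPolynomial.C c) :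
    ∃ b : K, b ≠ 0 ∧ p = MvPolynomial.C b := by
  have hunit : IsUnit p := isUnit_of_dvd_unit (Dvd.intro q h) (hc.isUnit.map MvPolynomial.C)
  obtain ⟨b, hb, rfl⟩ := MvPolynomial.isUnit_iff_eq_C_of_isReduced.mp hunit
  exact ⟨b, hb.ne_zero, rfl⟩

/-- A subring of `K[X]` is pseudo-polynomial over `D` as soon as its ring of constants is. -/
theorem IsPseudoPoly.isPseudoPolyPolyRing {K : Type*} [Field K] {σ : Type*}
    {D : Subring K} {R : Subring (MvPolynomial σ K)}
    (hK : Subfield.closure (D : Set K) = ⊤)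
    (h : IsPseudoPoly D (Subring.comap (MvPolynomial.C : K →+* MvPolynomial σ K) R)) :
    IsPseudoPolyPolyRing σ D R := by
  rintro ⟨r, hr⟩ ⟨a, ha, ha0, c, -, hac⟩
  obtain ⟨s, rfl⟩ := Ideal.mem_span_singleton'.mp ha
  have hc : c ≠ 0 := by
    rintro rfl
    exact ha0 (Subtype.ext (by simpa using hac))
  obtain ⟨b, hb, rfl⟩ := MvPolynomial.exists_eq_C_of_mul_eq_C hc ((mul_comm r s).trans hac)
  let A := Subring.comap (MvPolynomial.C : K →+* MvPolynomial σ K) R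
  let ι : A →+* R :=
    (MvPolynomial.C : K →+* MvPolynomial σ K).restrict A R fun _ hx => hx
  obtain ⟨d, hd, hspan⟩ := h ⟨b, hr⟩
    ⟨⟨b, hr⟩, Ideal.mem_span_singleton_self _, fun h0 => hb (congrArg Subtype.val h0),
      by simp [quotField, hK]⟩
  refine ⟨ι d, ⟨d, hd, rfl⟩, ?_⟩
  have hmap := congrArg (Ideal.map ι) hspan
  rwa [Ideal.map_span, Ideal.map_span, Set.image_singleton, Set.image_singleton] at hmap

/-- Let `D` be an integral domain with quotient field `K`, let `X` be a
family of indeterminates over `K`, and let `R` be a `D`-algebra with `D ⊆ R ⊆ K[X]`.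
If `R ∩ K` is pseudo-polynomial over `D`, then `R` is pseudo-polynomial over `D`.
In particular, if `R ∩ K = D`, then `R` is pseudo-polynomial over `D`. -/
theorem isPseudoPoly_of_subring_polynomial {K : Type*} [Field K] (σ : Type*)
    (D : Subring K) (R : Subring (MvPolynomial σ K))
    (hK : Subfield.closure (D : Set K) = ⊤)
    (hDR : ∀ c ∈ D, MvPolynomial.C c ∈ R) :
    (IsPseudoPoly D (Subring.comap (MvPolynomial.C : K →+* MvPolynomial σ K) R) →
        IsPseudoPolyPolyRing σ D R) ∧
    (Subring.comap (MvPolynomial.C : K →+* MvPolynomial σ K) R = D →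
        IsPseudoPolyPolyRing σ D R) := by
  exact ⟨fun h => h.isPseudoPolyPolyRing hK,
    fun h => IsPseudoPoly.isPseudoPolyPolyRing hK (h ▸ isPseudoPoly_self D)⟩
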